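/- Let $(M,g)$ be a smooth Riemannian manifold of dimension $2n+1$ ($n\ge 0$) with Levi-Civita connection $\nabla$, curvature tensor $R(X,Y)Z=\nabla_X\nabla_YZ-\nabla_Y\nabla_XZ-\nabla_{[X,Y]}Z$, Ricci tensor $S(Y,Z)=\operatorname{tr}\big(X\mapsto R(X,Y)Z\big)$, and Ricci operator $Q$ defined by $g(QX,Y)=S(X,Y)$. Suppose that $(M,g,\varphi,\xi,\eta)$ is a Kenmotsu manifold: $\varphi$ is a smooth $(1,1)$-tensor field, $\xi$ a smooth vector field and $\eta$ a smooth $1$-form with $$\varphi^2=-I+\eta\otimes\xi,\quad \eta(\xi)=1,\quad \eta(X)=g(X,\xi),\quad g(\varphi X,\varphi Y)=g(X,Y)-\eta(X)\eta(Y),$$ $$(\nabla_X\varphi)Y=g(\varphi X,Y)\xi-\eta(Y)\varphi X$$ for all smooth vector fields $X,Y$. Let $f$ be a smooth function on $M$ with gradient $Df$, let $\lambda,\mu,p$ be real constants, and suppose that $(g,Df,\lambda,\mu)$ is a gradient conformal $\eta$-Ricci soliton with potential function $f$ and conformal pressure $p$, that is, $$\operatorname{Hess}f+S+\Big[\lambda-\Big(\frac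 p2+\frac1{2n+1}\Big)\Big]g+\mu\,\eta\otimes\eta=0,$$ where $\operatorname{Hess}f(X,Y)=g(\nabla_XDf,Y)$. Then, for all smooth vector fields $X,Y$ on $M$, $$R(X,Y)Df=\big[(\nabla_YQ)X-(\nabla_XQ)Y\big]+\mu\big[\eta(X)Y-\eta(Y)X\big].$$ -/

import Mathlib

open Bundle
open scoped Manifold ContDiff

noncomputable section

namespace KenmotsuSoliton

/-! `M` is a smooth manifold with a smooth Riemannian metric: `g(u, v)` is `inner ℝ u v`
for `u v : TangentSpace I x`. -/

variable {E : Type*} [NormedAddCommGroup E] [NormedSpace ℝ E] [FiniteDimensional ℝ E]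
  {H : Type*} [TopologicalSpace H] {I : ModelWithCorners ℝ E H}
  {M : Type*} [TopologicalSpace M] [ChartedSpace H M] [IsManifold I ∞ M]
  [RiemannianBundle (fun x : M ↦ TangentSpace I x)]

instance (x : M) : FiniteDimensional ℝ (TangentSpace I x) :=
  inferInstanceAs (FiniteDimensional ℝ E)

/-- A smooth vector field on `M`. -/
def IsSmoothVF (X : Π x : M, TangentSpace I x) : Prop :=
  ContMDiff I (I.prod 𝓘(ℝ, E)) ∞ (fun x ↦ TotalSpace.mk' E x (X x))

/-- The connection `nab` is the Levi-Civita connection of the metric: it is torsion-free,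
`∇_X Y - ∇_Y X = [X, Y]`, and metric, `X g(Y, Z) = g(∇_X Y, Z) + g(Y, ∇_X Z)`.
In Mathlib's convention `nab Y x u` is `∇_u Y` at the point `x`. -/
structure IsLeviCivita (nab : CovariantDerivative I E (TangentSpace I : M → Type _)) :
    Prop where
  torsion_free : nab.torsion = 0
  metric : ∀ (Y Z : Π x : M, TangentSpace I x) (x : M) (u : TangentSpace I x),
    MDifferentiableAt I (I.prod 𝓘(ℝ, E)) (fun y ↦ TotalSpace.mk' E y (Y y)) x →
    MDifferentiableAt I (I.prod 𝓘(ℝ, E)) (fun y ↦ TotalSpace.mk' E y (Z y)) x →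
    mvfderiv I (fun y ↦ inner ℝ (Y y) (Z y)) x u
      = inner ℝ (nab Y x u) (Z x) + inner ℝ (Y x) (nab Z x u)

/-- The gradient `Df` of a function: `g(Df, u) = df(u)`. -/
def grad (f : M → ℝ) (x : M) : TangentSpace I x :=
  haveI : CompleteSpace (TangentSpace I x) := FiniteDimensional.complete ℝ _
  (InnerProductSpace.toDual ℝ (TangentSpace I x)).symm (mvfderiv I f x)

/-- The Hessian `Hess f (u, v) = g(∇_u Df, v)`. -/
def hess (nab : CovariantDerivative I E (TangentSpace I : M → Type _)) (f : M → ℝ) (x : M)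
    (u v : TangentSpace I x) : ℝ :=
  inner ℝ (nab (grad f) x u) v

/-- The covariant derivative `∇_X Y` of vector fields. -/
def nabla (nab : CovariantDerivative I E (TangentSpace I : M → Type _))
    (X Y : Π x : M, TangentSpace I x) (x : M) : TangentSpace I x :=
  nab Y x (X x)

/-- The curvature `R(X, Y)Z = ∇_X ∇_Y Z - ∇_Y ∇_X Z - ∇_[X, Y] Z`. -/
def curv (nab : CovariantDerivative I E (TangentSpace I : M → Type _))
    (X Y Z : Π x : M, TangentSpace I x) (x : M) : TangentSpace I x :=
  nabla nab X (nabla nab Y Z) x - nabla nab Y (nabla nab X Z) x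
    - nabla nab (VectorField.mlieBracket I X Y) Z x

/-- The Ricci tensor at `x`, the trace of `w ↦ R(w, u)v`:
`S(u, v) = ∑ i, g(R(e i, u)v, e i)` for an orthonormal basis `e` of the tangent space. The
tangent vectors are extended to vector fields which are smooth near `x` in order to apply `R`;
the value at `x` does not depend on the extensions, since `R` is a tensor. -/
def ricci (nab : CovariantDerivative I E (TangentSpace I : M → Type _)) (x : M)
    (u v : TangentSpace I x) : ℝ :=
  ∑ i, inner ℝ
    (curv nab (FiberBundle.extend E (stdOrthonormalBasis ℝ (TangentSpace I x) i))
      (FiberBundle.extend E u) (FiberBundle.extend E v) x)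
    (stdOrthonormalBasis ℝ (TangentSpace I x) i)

/-- The Ricci operator `Q`, `g(Qu, v) = S(u, v)`, written in an orthonormal basis:
`Qu = ∑ j, S(u, e j) e j`. -/
def ricciOp (nab : CovariantDerivative I E (TangentSpace I : M → Type _)) (x : M)
    (u : TangentSpace I x) : TangentSpace I x :=
  ∑ j, ricci nab x u (stdOrthonormalBasis ℝ (TangentSpace I x) j) •
    stdOrthonormalBasis ℝ (TangentSpace I x) j

/-- The covariant derivative `(∇_X A)Y = ∇_X (AY) - A(∇_X Y)` of a field `A` of
endomorphisms of the tangent spaces. -/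
def nablaEnd (nab : CovariantDerivative I E (TangentSpace I : M → Type _))
    (A : Π x : M, TangentSpace I x → TangentSpace I x)
    (X Y : Π x : M, TangentSpace I x) (x : M) : TangentSpace I x :=
  nabla nab X (fun y ↦ A y (Y y)) x - A x (nabla nab X Y x)

/-- `(g, φ, ξ, η)` is an almost contact metric structure on `M`; `φ`, `ξ`, `η` are smooth. -/
structure IsAlmostContactMetric (φ : Π x : M, TangentSpace I x →L[ℝ] TangentSpace I x)
    (ξ : Π x : M, TangentSpace I x) (η : Π x : M, TangentSpace I x →L[ℝ] ℝ) : Prop where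
  smooth_phi : ContMDiff I (I.prod 𝓘(ℝ, E →L[ℝ] E)) ∞
    (fun x ↦ TotalSpace.mk' (E →L[ℝ] E)
      (E := fun x : M ↦ TangentSpace I x →L[ℝ] TangentSpace I x) x (φ x))
  smooth_xi : IsSmoothVF ξ
  smooth_eta : ContMDiff I (I.prod 𝓘(ℝ, E →L[ℝ] ℝ)) ∞
    (fun x ↦ TotalSpace.mk' (E →L[ℝ] ℝ) (E := fun x : M ↦ TangentSpace I x →L[ℝ] ℝ) x (η x))
  phi_phi : ∀ (x : M) (u : TangentSpace I x), φ x (φ x u) = -u + η x u • ξ x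
  eta_xi : ∀ x : M, η x (ξ x) = 1
  eta_eq : ∀ (x : M) (u : TangentSpace I x), η x u = inner ℝ u (ξ x)
  inner_phi : ∀ (x : M) (u v : TangentSpace I x),
    inner ℝ (φ x u) (φ x v) = inner ℝ u v - η x u * η x v

/-- `(M, g, φ, ξ, η)` with Levi-Civita connection `nab` is a Kenmotsu manifold:
`(∇_X φ)Y = g(φX, Y)ξ - η(Y)φX`. -/
structure IsKenmotsu (nab : CovariantDerivative I E (TangentSpace I : M → Type _))
    (φ : Π x : M, TangentSpace I x →L[ℝ] TangentSpace I x)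
    (ξ : Π x : M, TangentSpace I x) (η : Π x : M, TangentSpace I x →L[ℝ] ℝ) : Prop where
  almostContactMetric : IsAlmostContactMetric φ ξ η
  leviCivita : IsLeviCivita nab
  nabla_phi : ∀ X Y : Π x : M, TangentSpace I x, IsSmoothVF X → IsSmoothVF Y → ∀ x : M,
    nablaEnd nab (fun y ↦ φ y) X Y x
      = inner ℝ (φ x (X x)) (Y x) • ξ x - η x (Y x) • φ x (X x)

/-- `(g, Df, lam, mu)` is a gradient conformal `η`-Ricci soliton with smooth potential function
`f` and conformal pressure `p` on the Riemannian manifold `M` of dimension `dim E`: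
`Hess f + S + [lam - (p/2 + 1/dim M)] g + mu η ⊗ η = 0`. -/
structure IsGradConformalEtaRicciSoliton
    (nab : CovariantDerivative I E (TangentSpace I : M → Type _))
    (η : Π x : M, TangentSpace I x →L[ℝ] ℝ) (f : M → ℝ) (lam mu p : ℝ) : Prop where
  smooth : ContMDiff I 𝓘(ℝ, ℝ) ∞ f
  eqn : ∀ (x : M) (u v : TangentSpace I x),
    hess nab f x u v + ricci nab x u v
      + (lam - (p / 2 + 1 / (Module.finrank ℝ E : ℝ))) * inner ℝ u v
      + mu * (η x u * η x v) = 0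

end KenmotsuSoliton

end

noncomputable section

namespace KenmotsuSoliton

section General

variable {E : Type*} [NormedAddCommGroup E] [NormedSpace ℝ E]
  {H : Type*} [TopologicalSpace H] {I : ModelWithCorners ℝ E H}
  {M : Type*} [TopologicalSpace M] [ChartedSpace H M]

/-- The determinant of a matrix of `C^k` functions is `C^k`. -/
lemma contMDiffAt_det {ι : Type*} [Fintype ι] [DecidableEq ι] {k : ℕ∞ω}
    {A : M → Matrix ι ι ℝ} {x : M}
    (hA : ∀ i j, ContMDiffAt I 𝓘(ℝ, ℝ) k (fun y ↦ A y i j) x) :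
    ContMDiffAt I 𝓘(ℝ, ℝ) k (fun y ↦ (A y).det) x := by
  simp only [Matrix.det_apply]
  refine contMDiffAt_finsetSum fun σ _ ↦ ?_
  simp only [Units.smul_def, zsmul_eq_mul]
  exact contMDiffAt_const.mul (contMDiffAt_finsetProd fun i _ ↦ hA _ _)

/-- The derivative `X f` of a smooth function along a smooth vector field is smooth. -/
lemma contMDiffAt_mvfderiv_apply [IsManifold I ∞ M] {f : M → ℝ}
    {X : Π x : M, TangentSpace I x} {x : M}
    (hf : ContMDiffAt I 𝓘(ℝ, ℝ) ∞ f x)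
    (hX : ContMDiffAt I (I.prod 𝓘(ℝ, E)) ∞ (fun y ↦ TotalSpace.mk' E y (X y)) x) :
    ContMDiffAt I 𝓘(ℝ, ℝ) ∞ (fun y ↦ mvfderiv I f y (X y)) x := by
  have : IsManifold I 1 M := IsManifold.of_le (n := ∞) (by norm_cast)
  have h1 := (hf.mfderiv_const (m := ∞) (by simp)).clm_apply_of_inCoordinates hX hf
  exact (contMDiff_snd_tangentBundle_modelSpace ℝ 𝓘(ℝ, ℝ)).contMDiffAt.comp x h1

lemma contMDiffAt_inner [IsManifold I ∞ M]
    [RiemannianBundle (fun x : M ↦ TangentSpace I x)]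
    [IsContMDiffRiemannianBundle I ∞ E (fun x : M ↦ TangentSpace I x)]
    {X Y : Π x : M, TangentSpace I x} {x : M}
    (hX : ContMDiffAt I (I.prod 𝓘(ℝ, E)) ∞ (fun y ↦ TotalSpace.mk' E y (X y)) x)
    (hY : ContMDiffAt I (I.prod 𝓘(ℝ, E)) ∞ (fun y ↦ TotalSpace.mk' E y (Y y)) x) :
    ContMDiffAt I 𝓘(ℝ, ℝ) ∞ (fun y ↦ inner ℝ (X y) (Y y)) x :=
  ContMDiffAt.inner_bundle (E := fun x : M ↦ TangentSpace I x) (b := id) hX hY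

end General

variable {E : Type*} [NormedAddCommGroup E] [NormedSpace ℝ E] [FiniteDimensional ℝ E]
  {H : Type*} [TopologicalSpace H] {I : ModelWithCorners ℝ E H}
  {M : Type*} [TopologicalSpace M] [ChartedSpace H M] [IsManifold I ∞ M]
  [RiemannianBundle (fun x : M ↦ TangentSpace I x)]

/-- A vector field is smooth as soon as its inner products with the vector fields of a smooth local
frame are. -/
lemma contMDiffAt_of_inner_localFrame
    [IsContMDiffRiemannianBundle I ∞ E (fun x : M ↦ TangentSpace I x)]
    {ι : Type*} [Fintype ι] {s : ι → Π x : M, TangentSpace I x} {u : Set M}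
    (hs : IsLocalFrameOn I E ∞ s u) {V : Π x : M, TangentSpace I x} {x : M} (hu : u ∈ nhds x)
    (hV : ∀ i, ContMDiffAt I 𝓘(ℝ, ℝ) ∞ (fun y ↦ inner ℝ (s i y) (V y)) x) :
    ContMDiffAt I (I.prod 𝓘(ℝ, E)) ∞ (fun y ↦ TotalSpace.mk' E y (V y)) x := by
  classical
  have hsx (i : ι) : ContMDiffAt I (I.prod 𝓘(ℝ, E)) ∞ (fun y ↦ TotalSpace.mk' E y (s i y)) x :=
    (hs.contMDiffOn i).contMDiffAt hu
  let G (y : M) : Matrix ι ι ℝ := Matrix.gram ℝ (fun i ↦ s i y)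
  have hG (i j : ι) : ContMDiffAt I 𝓘(ℝ, ℝ) ∞ (fun y ↦ G y i j) x :=
    contMDiffAt_inner (hsx i) (hsx j)
  have hdet : ∀ y ∈ u, (G y).det ≠ 0 := fun y hy ↦
    Matrix.det_gram_ne_zero_iff_linearIndependent.2 (hs.linearIndependent hy)
  refine hs.contMDiffAt_of_coeff (fun i ↦ ?_) hu
  have key : ∀ y ∈ u, hs.coeff i y (V y)
      = ((G y).det)⁻¹ * ((G y).updateCol i (fun j ↦ inner ℝ (s j y) (V y))).det := by
    intro y hy
    have hb : (G y).mulVec (fun j ↦ hs.coeff j y (V y)) = fun j ↦ inner ℝ (s j y) (V y) := by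
      ext j
      conv_rhs => rw [hs.coeff_sum_eq V hy, inner_sum]
      simp only [Matrix.mulVec, dotProduct, G, Matrix.gram_apply, inner_smul_right]
      exact Finset.sum_congr rfl fun _ _ ↦ mul_comm _ _
    rw [← Matrix.cramer_apply, ← hb, Matrix.cramer_eq_adjugate_mulVec, Matrix.mulVec_mulVec,
      Matrix.adjugate_mul, Matrix.smul_mulVec, Matrix.one_mulVec, Pi.smul_apply, smul_eq_mul,
      inv_mul_cancel_left₀ (hdet y hy)]
  have hsm : ContMDiffAt I 𝓘(ℝ, ℝ) ∞ (fun y ↦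
      ((G y).det)⁻¹ * ((G y).updateCol i (fun j ↦ inner ℝ (s j y) (V y))).det) x := by
    refine ((contMDiffAt_det hG).inv₀ (hdet x (mem_of_mem_nhds hu))).mul
      (contMDiffAt_det fun j l ↦ ?_)
    by_cases h : l = i
    · subst h; simpa using hV j
    · simpa [Matrix.updateCol_apply, h] using hG j l
  exact hsm.congr_of_eventuallyEq (Filter.eventually_of_mem hu key)

/-- A vector field is smooth near `x` as soon as its inner products with smooth local vector fields
are smooth at `x`. -/
lemma contMDiffAt_of_forall_inner
    [IsContMDiffRiemannianBundle I ∞ E (fun x : M ↦ TangentSpace I x)]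
    {V : Π x : M, TangentSpace I x} {x : M}
    (hV : ∀ Z : Π x : M, TangentSpace I x,
      (∀ᶠ y in nhds x, ContMDiffAt I (I.prod 𝓘(ℝ, E)) ∞ (fun y ↦ TotalSpace.mk' E y (Z y)) y) →
      ContMDiffAt I 𝓘(ℝ, ℝ) ∞ (fun y ↦ inner ℝ (Z y) (V y)) x) :
    ContMDiffAt I (I.prod 𝓘(ℝ, E)) ∞ (fun y ↦ TotalSpace.mk' E y (V y)) x := by
  let e := trivializationAt E (TangentSpace I : M → Type _) x
  have hs := e.isLocalFrameOn_localFrame_baseSet I ∞ (Module.finBasis ℝ E)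
  have hu : e.baseSet ∈ nhds x :=
    e.open_baseSet.mem_nhds (FiberBundle.mem_baseSet_trivializationAt' x)
  exact contMDiffAt_of_inner_localFrame hs hu fun i ↦
    hV _ (Filter.eventually_of_mem hu fun y hy ↦ hs.contMDiffAt e.open_baseSet hy i)

lemma inner_grad (f : M → ℝ) (x : M) (u : TangentSpace I x) :
    inner ℝ (grad f x) u = mvfderiv I f x u := by
  simp [grad]

/-- The gradient of a smooth function is smooth. -/
lemma isSmoothVF_grad [IsContMDiffRiemannianBundle I ∞ E (fun x : M ↦ TangentSpace I x)]
    {f : M → ℝ} (hf : ContMDiff I 𝓘(ℝ, ℝ) ∞ f) :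
    IsSmoothVF (I := I) (grad f) := fun x ↦ by
  refine contMDiffAt_of_forall_inner fun Z hZ ↦ ?_
  simp only [real_inner_comm (grad f _), inner_grad]
  exact contMDiffAt_mvfderiv_apply (hf x) hZ.self_of_nhds

lemma IsLeviCivita.sub_eq_mlieBracket
    {nab : CovariantDerivative I E (TangentSpace I : M → Type _)} (h : IsLeviCivita nab)
    {X Y : Π x : M, TangentSpace I x} {x : M}
    (hX : MDifferentiableAt I (I.prod 𝓘(ℝ, E)) (fun y ↦ TotalSpace.mk' E y (X y)) x)
    (hY : MDifferentiableAt I (I.prod 𝓘(ℝ, E)) (fun y ↦ TotalSpace.mk' E y (Y y)) x) :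
    nab Y x (X x) - nab X x (Y x) = VectorField.mlieBracket I X Y x :=
  nab.torsion_eq_zero_iff.1 h.torsion_free hX hY

/-- The Koszul formula. -/
lemma IsLeviCivita.koszul
    {nab : CovariantDerivative I E (TangentSpace I : M → Type _)} (h : IsLeviCivita nab)
    {X Y Z : Π x : M, TangentSpace I x} {x : M}
    (hX : MDifferentiableAt I (I.prod 𝓘(ℝ, E)) (fun y ↦ TotalSpace.mk' E y (X y)) x)
    (hY : MDifferentiableAt I (I.prod 𝓘(ℝ, E)) (fun y ↦ TotalSpace.mk' E y (Y y)) x)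
    (hZ : MDifferentiableAt I (I.prod 𝓘(ℝ, E)) (fun y ↦ TotalSpace.mk' E y (Z y)) x) :
    inner ℝ (Z x) (nab Y x (X x)) = 2⁻¹ *
      (mvfderiv I (fun y ↦ inner ℝ (Y y) (Z y)) x (X x)
        + mvfderiv I (fun y ↦ inner ℝ (Z y) (X y)) x (Y x)
        - mvfderiv I (fun y ↦ inner ℝ (X y) (Y y)) x (Z x)
        + inner ℝ (VectorField.mlieBracket I X Y x) (Z x)
        - inner ℝ (VectorField.mlieBracket I Y Z x) (X x)
        + inner ℝ (VectorField.mlieBracket I Z X x) (Y x)) := by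
  rw [← h.sub_eq_mlieBracket hX hY, ← h.sub_eq_mlieBracket hY hZ, ← h.sub_eq_mlieBracket hZ hX,
    h.metric _ _ _ _ hY hZ, h.metric _ _ _ _ hZ hX, h.metric _ _ _ _ hX hY]
  simp only [inner_sub_left]
  rw [real_inner_comm (Z x) (nab Y x (X x)), real_inner_comm (nab Z x (X x)) (Y x),
    real_inner_comm (nab X x (Y x)) (Z x), real_inner_comm (nab Y x (Z x)) (X x)]
  ring

/-- The Levi-Civita connection maps smooth vector fields to smooth vector fields. -/
lemma IsLeviCivita.isSmoothVF_nabla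
    [IsContMDiffRiemannianBundle I ∞ E (fun x : M ↦ TangentSpace I x)]
    {nab : CovariantDerivative I E (TangentSpace I : M → Type _)} (h : IsLeviCivita nab)
    {X Y : Π x : M, TangentSpace I x} (hX : IsSmoothVF X) (hY : IsSmoothVF Y) :
    IsSmoothVF (nabla nab X Y) := fun x ↦ by
  refine contMDiffAt_of_forall_inner fun Z hZ ↦ ?_
  have hZx := hZ.self_of_nhds
  have hlie {U V : Π x : M, TangentSpace I x}
      (hU : ContMDiffAt I (I.prod 𝓘(ℝ, E)) ∞ (fun y ↦ TotalSpace.mk' E y (U y)) x)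
      (hV : ContMDiffAt I (I.prod 𝓘(ℝ, E)) ∞ (fun y ↦ TotalSpace.mk' E y (V y)) x) :
      ContMDiffAt I (I.prod 𝓘(ℝ, E)) ∞
        (fun y ↦ TotalSpace.mk' E y (VectorField.mlieBracket I U V y)) x := by
    have : IsManifold I (minSmoothness ℝ 2) M := by
      rw [minSmoothness_of_isRCLikeNormedField]; infer_instance
    have : IsManifold I (((⊤ : ℕ∞) : ℕ∞ω) + 1) M := by simpa
    exact ContMDiffAt.mlieBracket_vectorField (n := ⊤) (m := ⊤) hU hV (by simp)
  refine ContMDiffAt.congr_of_eventuallyEq (f := fun y ↦ 2⁻¹ *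
      (mvfderiv I (fun y ↦ inner ℝ (Y y) (Z y)) y (X y)
        + mvfderiv I (fun y ↦ inner ℝ (Z y) (X y)) y (Y y)
        - mvfderiv I (fun y ↦ inner ℝ (X y) (Y y)) y (Z y)
        + inner ℝ (VectorField.mlieBracket I X Y y) (Z y)
        - inner ℝ (VectorField.mlieBracket I Y Z y) (X y)
        + inner ℝ (VectorField.mlieBracket I Z X y) (Y y))) ?_
    (hZ.mono fun y hy ↦ h.koszul (hX.mdifferentiableAt (by simp)) (hY.mdifferentiableAt (by simp))
      (hy.mdifferentiableAt (by simp)))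
  refine contMDiffAt_const.mul ?_
  exact (((((contMDiffAt_mvfderiv_apply (contMDiffAt_inner (hY x) hZx) (hX x)).add
    (contMDiffAt_mvfderiv_apply (contMDiffAt_inner hZx (hX x)) (hY x))).sub
    (contMDiffAt_mvfderiv_apply (contMDiffAt_inner (hX x) (hY x)) hZx)).add
    (contMDiffAt_inner (hlie (hX x) (hY x)) hZx)).sub
    (contMDiffAt_inner (hlie (hY x) hZx) (hX x))).add
    (contMDiffAt_inner (hlie hZx (hX x)) (hY x))

section Kenmotsu

variable {φ : Π x : M, TangentSpace I x →L[ℝ] TangentSpace I x}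
  {ξ : Π x : M, TangentSpace I x} {η : Π x : M, TangentSpace I x →L[ℝ] ℝ}

lemma IsAlmostContactMetric.phi_xi (h : IsAlmostContactMetric φ ξ η) (x : M) :
    φ x (ξ x) = 0 := by
  have h1 := h.inner_phi x (ξ x) (ξ x)
  rw [← h.eta_eq, h.eta_xi] at h1
  rw [← inner_self_eq_zero (𝕜 := ℝ), h1]
  ring

lemma IsAlmostContactMetric.eta_phi (h : IsAlmostContactMetric φ ξ η) (x : M)
    (u : TangentSpace I x) : η x (φ x u) = 0 := by
  have h1 := h.phi_phi x (φ x u)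
  rw [h.phi_phi x u, map_add, map_neg, map_smul, h.phi_xi, smul_zero, add_zero, left_eq_add] at h1
  have h2 := congrArg (η x) h1
  simpa [h.eta_xi] using h2

/-- On a Kenmotsu manifold, `∇_X ξ = X - η(X) ξ`. -/
lemma IsKenmotsu.nabla_xi {nab : CovariantDerivative I E (TangentSpace I : M → Type _)}
    (h : IsKenmotsu nab φ ξ η) {X : Π x : M, TangentSpace I x} (hX : IsSmoothVF X) (x : M) :
    nab ξ x (X x) = X x - η x (X x) • ξ x := by
  have hc := h.almostContactMetric
  have hξ := (hc.smooth_xi x).mdifferentiableAt (by simp)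
  have h0 : (fun y ↦ φ y (ξ y)) = 0 := funext hc.phi_xi
  have h1 := h.nabla_phi X ξ hX hc.smooth_xi x
  simp only [nablaEnd, nabla, h0, nab.zero, hc.eta_xi, ← hc.eta_eq, hc.eta_phi, one_smul,
    zero_smul, zero_sub, Pi.zero_apply, zero_apply, neg_inj] at h1
  have h2 := h.leviCivita.metric ξ ξ x (X x) hξ hξ
  simp only [← hc.eta_eq, hc.eta_xi, mvfderiv_const, zero_apply] at h2
  rw [real_inner_comm, ← hc.eta_eq] at h2
  have h3 := congrArg (φ x) h1
  rw [hc.phi_phi, hc.phi_phi, show η x (nab ξ x (X x)) = 0 by linarith, zero_smul, add_zero] at h3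
  rw [← neg_inj, h3]
  abel

/-- On a Kenmotsu manifold, `(∇_Y η) X = g(X, Y) - η(X) η(Y)`. -/
lemma IsKenmotsu.mvfderiv_eta {nab : CovariantDerivative I E (TangentSpace I : M → Type _)}
    (h : IsKenmotsu nab φ ξ η) {X Y : Π x : M, TangentSpace I x} (hX : IsSmoothVF X)
    (hY : IsSmoothVF Y) (x : M) :
    mvfderiv I (fun y ↦ η y (X y)) x (Y x)
      = η x (nab X x (Y x)) + inner ℝ (X x) (Y x) - η x (X x) * η x (Y x) := by
  have hc := h.almostContactMetric
  simp only [hc.eta_eq _ (X _)]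
  rw [h.leviCivita.metric X ξ x (Y x) ((hX x).mdifferentiableAt (by simp))
    ((hc.smooth_xi x).mdifferentiableAt (by simp)), h.nabla_xi hY, inner_sub_right,
    inner_smul_right, hc.eta_eq x (nab X x (Y x)), hc.eta_eq x (Y x)]
  ring

end Kenmotsu

lemma ricciOp_eq_of_forall_inner
    {nab : CovariantDerivative I E (TangentSpace I : M → Type _)} {x : M}
    {u w : TangentSpace I x} (hw : ∀ v, ricci nab x u v = inner ℝ w v) :
    ricciOp nab x u = w := by
  simp only [ricciOp, hw]
  simpa only [real_inner_comm] using (stdOrthonormalBasis ℝ (TangentSpace I x)).sum_repr' w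

section Soliton

variable {φ : Π x : M, TangentSpace I x →L[ℝ] TangentSpace I x}
  {ξ : Π x : M, TangentSpace I x} {η : Π x : M, TangentSpace I x →L[ℝ] ℝ}
  {nab : CovariantDerivative I E (TangentSpace I : M → Type _)} {f : M → ℝ} {lam mu p : ℝ}

/-- The soliton equation, solved for the Ricci operator. -/
lemma IsGradConformalEtaRicciSoliton.ricciOp_eq
    (h : IsGradConformalEtaRicciSoliton nab η f lam mu p) (hc : IsAlmostContactMetric φ ξ η)
    (x : M) (u : TangentSpace I x) :
    ricciOp nab x u = (-1 : ℝ) • nab (grad f) x u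
      + ((-(lam - (p / 2 + 1 / (Module.finrank ℝ E : ℝ)))) • u + (-mu * η x u) • ξ x) := by
  refine ricciOp_eq_of_forall_inner fun v ↦ ?_
  have h1 := h.eqn x u v
  rw [hess, hc.eta_eq x v, real_inner_comm] at h1
  simp only [inner_add_left, inner_smul_left, conj_trivial]
  rw [real_inner_comm v (nab (grad f) x u), real_inner_comm v (ξ x)]
  linarith

/-- The covariant derivative of the Ricci operator of a gradient conformal `η`-Ricci soliton on a
Kenmotsu manifold. -/
lemma IsGradConformalEtaRicciSoliton.nablaEnd_ricciOp
    [IsContMDiffRiemannianBundle I ∞ E (fun x : M ↦ TangentSpace I x)]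
    (h : IsGradConformalEtaRicciSoliton nab η f lam mu p) (hK : IsKenmotsu nab φ ξ η)
    {X Y : Π x : M, TangentSpace I x} (hX : IsSmoothVF X) (hY : IsSmoothVF Y) (x : M) :
    nablaEnd nab (ricciOp nab) Y X x = nab (grad f) x (nab X x (Y x))
      - nabla nab Y (nabla nab X (grad f)) x
      - mu • (η x (X x) • Y x + (inner ℝ (X x) (Y x) - 2 * (η x (X x) * η x (Y x))) • ξ x) := by
  have hc := hK.almostContactMetric
  have hmd {Z : Π x : M, TangentSpace I x} (hZ : IsSmoothVF Z) :
      MDifferentiableAt I (I.prod 𝓘(ℝ, E)) (fun y ↦ TotalSpace.mk' E y (Z y)) x :=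
    (hZ x).mdifferentiableAt (by simp)
  have hη : MDifferentiableAt I 𝓘(ℝ, ℝ) (fun y ↦ η y (X y)) x := by
    simp only [hc.eta_eq]
    exact (contMDiffAt_inner (hX x) (hc.smooth_xi x)).mdifferentiableAt (by simp)
  have hg : MDifferentiableAt I 𝓘(ℝ, ℝ) ((fun _ ↦ -mu) * fun y ↦ η y (X y)) x :=
    mdifferentiableAt_const.mul hη
  have hD := hmd (hK.leviCivita.isSmoothVF_nabla hX (isSmoothVF_grad h.smooth))
  set c : ℝ := -(lam - (p / 2 + 1 / (Module.finrank ℝ E : ℝ))) with hcdef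
  have hQ : (fun y ↦ ricciOp nab y (X y)) = (-1 : ℝ) • nabla nab X (grad f)
      + (c • X + ((fun _ ↦ -mu) * fun y ↦ η y (X y)) • ξ) := by
    funext y
    rw [h.ricciOp_eq hc]
    rfl
  have cov := nab.isCovariantDerivativeOn (s := Set.univ)
  have hξ := hmd hc.smooth_xi
  have hD' := MDifferentiableAt.smul_const_section (a := (-1 : ℝ)) hD
  have hX' := MDifferentiableAt.smul_const_section (a := c) (hmd hX)
  rw [nablaEnd, nabla, hQ, h.ricciOp_eq hc,
    cov.add hD' (mdifferentiableAt_add_section hX' (hg.smul_section hξ)),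
    cov.add hX' (hg.smul_section hξ), cov.smul_const _ hD, cov.smul_const _ (hmd hX),
    cov.leibniz hξ hg, mvfderiv_mul mdifferentiableAt_const hη]
  simp only [add_apply, smul_apply, Pi.mul_apply,
    ContinuousLinearMap.smulRight_apply, mvfderiv_const, hK.mvfderiv_eta hX hY, hK.nabla_xi hY,
    nabla, zero_apply, smul_eq_mul, ← hcdef]
  module

end Soliton

end KenmotsuSoliton

end

theorem curvature_grad_eq_of_gradient_conformal_eta_ricci_soliton
    {n : ℕ} {M : Type*} [TopologicalSpace M] [T2Space M] [SecondCountableTopology M]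
    [ChartedSpace (EuclideanSpace ℝ (Fin (2 * n + 1))) M] [IsManifold (𝓡 (2 * n + 1)) ∞ M]
    [RiemannianBundle (fun x : M ↦ TangentSpace (𝓡 (2 * n + 1)) x)]
    [IsContMDiffRiemannianBundle (𝓡 (2 * n + 1)) ∞ (EuclideanSpace ℝ (Fin (2 * n + 1)))
      (fun x : M ↦ TangentSpace (𝓡 (2 * n + 1)) x)]
    (nab : CovariantDerivative (𝓡 (2 * n + 1)) (EuclideanSpace ℝ (Fin (2 * n + 1)))
      (TangentSpace (𝓡 (2 * n + 1)) : M → Type _))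
    (φ : Π x : M, TangentSpace (𝓡 (2 * n + 1)) x →L[ℝ] TangentSpace (𝓡 (2 * n + 1)) x)
    (ξ : Π x : M, TangentSpace (𝓡 (2 * n + 1)) x)
    (η : Π x : M, TangentSpace (𝓡 (2 * n + 1)) x →L[ℝ] ℝ)
    (hK : KenmotsuSoliton.IsKenmotsu nab φ ξ η)
    (f : M → ℝ) (lam mu p : ℝ)
    (hsol : KenmotsuSoliton.IsGradConformalEtaRicciSoliton nab η f lam mu p)
    (X Y : Π x : M, TangentSpace (𝓡 (2 * n + 1)) x)
    (hX : KenmotsuSoliton.IsSmoothVF X) (hY : KenmotsuSoliton.IsSmoothVF Y) (x : M) :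
    KenmotsuSoliton.curv nab X Y (KenmotsuSoliton.grad f) x
      = (KenmotsuSoliton.nablaEnd nab (KenmotsuSoliton.ricciOp nab) Y X x
          - KenmotsuSoliton.nablaEnd nab (KenmotsuSoliton.ricciOp nab) X Y x)
        + mu • (η x (X x) • Y x - η x (Y x) • X x) := by
  rw [hsol.nablaEnd_ricciOp hK hX hY, hsol.nablaEnd_ricciOp hK hY hX, KenmotsuSoliton.curv]
  have hlie := hK.leviCivita.sub_eq_mlieBracket ((hX x).mdifferentiableAt (by simp))
    ((hY x).mdifferentiableAt (by simp))
  simp only [KenmotsuSoliton.nabla, ← hlie, map_sub, real_inner_comm (X x) (Y x)]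
  module
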